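/- arXiv:2510.01067 — 2 statements merged into one kernel-verified Lean document; each statement's English description precedes it below -/
import Mathlib

section
/- Fix reals γ_h, γ_u, γ_v, γ_Q > 0, sequences H, U, V : ℕ → ℂ with |H_i| ≤ γ_h, |U_i| ≤ γ_u, |V_i| ≤ γ_v for all i, and bounds γ_i ∈ (0, γ_Q]. Define μ_M := inf{ ‖diag(H_1,…,H_M) − diag(U_1,…,U_M)·Z·diag(V_1,…,V_M)‖ : Z an M×M complex matrix with |Z_{ii}| ≤ γ_i }. Then for every n, every α ≥ 0, every M ≤ n, and every Q ∈ 𝒬^α(n): ‖T_n Φ(Q)‖ ≥ μ_M − √M(γ_h + (1+α)γ_Q γ_u γ_v)/√n. -/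
/-- The ℓ²→ℓ² operator norm of a complex matrix. -/
noncomputable def l2opNorm {m n : Type*} [Fintype m] [Fintype n] [DecidableEq n]
    (A : Matrix m n ℂ) : ℝ :=
  ‖LinearMap.toContinuousLinearMap (Matrix.toEuclideanLin A)‖

/-- The constraint set `𝒬^α(n)`: α-column diagonally dominant matrices with `|Q_{ii}| ≤ γ i`. -/
def QSet (n : ℕ) (α : ℝ) (γ : ℕ → ℝ) : Set (Matrix (Fin n) (Fin n) ℂ) :=
  {Q | (∀ j, ∑ i ∈ Finset.univ.erase j, ‖Q i j‖ ≤ α * ‖Q j j‖) ∧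
       ∀ i, ‖Q i i‖ ≤ γ (i : ℕ)}

/-- The closed-loop map `Φ(Q) = diag H − diag U ⬝ Q ⬝ diag V`. -/
noncomputable def PhiMat (n : ℕ) (H U V : ℕ → ℂ) (Q : Matrix (Fin n) (Fin n) ℂ) :
    Matrix (Fin n) (Fin n) ℂ :=
  Matrix.diagonal (fun i : Fin n => H i) -
    Matrix.diagonal (fun i : Fin n => U i) * Q * Matrix.diagonal (fun i : Fin n => V i)

/-- The deviation-from-average matrix `T_n = I_n − (1/n) 𝟙𝟙ᵀ`. -/
noncomputable def Tmat (n : ℕ) : Matrix (Fin n) (Fin n) ℂ :=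
  1 - ((n : ℂ)⁻¹) • Matrix.of (fun _ _ : Fin n => (1 : ℂ))

/-- `μ_M`: the optimal value of the decentralized `M`-agent model-matching problem. -/
noncomputable def muSeq (H U V : ℕ → ℂ) (γ : ℕ → ℝ) (M : ℕ) : ℝ :=
  sInf {r : ℝ | ∃ Z : Matrix (Fin M) (Fin M) ℂ, (∀ i, ‖Z i i‖ ≤ γ (i : ℕ)) ∧
    r = l2opNorm (Matrix.diagonal (fun i : Fin M => H i) -
      Matrix.diagonal (fun i : Fin M => U i) * Z * Matrix.diagonal (fun i : Fin M => V i))}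

open scoped Matrix.Norms.L2Operator in
lemma l2opNorm_eq_norm {m n : Type*} [Fintype m] [Fintype n] [DecidableEq n]
    (A : Matrix m n ℂ) : l2opNorm A = ‖A‖ := rfl

lemma l2opNorm_nonneg {m n : Type*} [Fintype m] [Fintype n] [DecidableEq n]
    (A : Matrix m n ℂ) : 0 ≤ l2opNorm A := norm_nonneg _

/-- Passing to a submatrix does not increase the operator norm. -/
lemma l2opNorm_submatrix_le {M n : ℕ} (A : Matrix (Fin n) (Fin n) ℂ) (e : Fin M → Fin n)
    (he : Function.Injective e) : l2opNorm (A.submatrix e e) ≤ l2opNorm A := by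
  open scoped Matrix.Norms.L2Operator in
  rw [l2opNorm_eq_norm, l2opNorm_eq_norm]
  let J : Matrix (Fin n) (Fin M) ℂ := (1 : Matrix (Fin n) (Fin n) ℂ).submatrix id e
  have hJJ : J.conjTranspose * J = 1 := by
    ext i j
    simp [J, Matrix.mul_apply, Matrix.one_apply, he.eq_iff, apply_ite]
  have hA : A.submatrix e e = J.conjTranspose * A * J := by
    ext i j
    simp [J, Matrix.mul_apply, Matrix.one_apply, apply_ite]
  have h1 : ‖(1 : Matrix (Fin M) (Fin M) ℂ)‖ ≤ 1 := by
    rw [← Matrix.diagonal_one, Matrix.l2_opNorm_diagonal]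
    exact (pi_norm_le_iff_of_nonneg zero_le_one).2 (fun i => by simp)
  have hJ : ‖J‖ ≤ 1 := by
    have h := Matrix.l2_opNorm_conjTranspose_mul_self J
    rw [hJJ] at h
    nlinarith [norm_nonneg J]
  have hJ' : ‖J.conjTranspose‖ ≤ 1 := by rwa [Matrix.l2_opNorm_conjTranspose]
  rw [hA]
  calc ‖J.conjTranspose * A * J‖ ≤ ‖J.conjTranspose * A‖ * ‖J‖ := Matrix.l2_opNorm_mul _ _
    _ ≤ ‖J.conjTranspose * A‖ * 1 := by gcongr
    _ ≤ ‖J.conjTranspose‖ * ‖A‖ := by rw [mul_one]; exact Matrix.l2_opNorm_mul _ _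
    _ ≤ 1 * ‖A‖ := by gcongr
    _ = ‖A‖ := one_mul _

lemma l2opNorm_le_of_entries {M : ℕ} (A : Matrix (Fin M) (Fin M) ℂ) (b : ℝ) (hb : 0 ≤ b)
    (h : ∀ i j, ‖A i j‖ ≤ b) : l2opNorm A ≤ M * b := by
  unfold l2opNorm
  refine ContinuousLinearMap.opNorm_le_bound _ (by positivity) fun x => ?_
  refine (sq_le_sq₀ (by positivity) (by positivity)).mp ?_
  have hi : ∀ i, ‖(A.mulVec x.ofLp) i‖ ≤ b * ∑ j, ‖x j‖ := by
    intro i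
    rw [Finset.mul_sum]
    refine (norm_sum_le Finset.univ (fun j => A i j * x.ofLp j)).trans
      (Finset.sum_le_sum fun j _ => ?_)
    rw [norm_mul]
    exact mul_le_mul_of_nonneg_right (h i j) (norm_nonneg _)
  have hcs : (∑ j, ‖x j‖) ^ 2 ≤ M * ∑ j, ‖x j‖ ^ 2 := by
    simpa using sq_sum_le_card_mul_sum_sq (s := (Finset.univ : Finset (Fin M)))
      (f := fun j => ‖x j‖)
  rw [EuclideanSpace.norm_sq_eq, mul_pow, EuclideanSpace.norm_sq_eq x]
  calc _ ≤ ∑ i : Fin M, (b * ∑ j, ‖x j‖) ^ 2 :=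
        Finset.sum_le_sum fun i _ => pow_le_pow_left₀ (norm_nonneg _) (hi i) 2
    _ = M * (b ^ 2 * (∑ j, ‖x j‖) ^ 2) := by simp [mul_pow]
    _ ≤ M * (b ^ 2 * (M * ∑ j, ‖x j‖ ^ 2)) := by gcongr
    _ = _ := by ring

/-- for every `n`, `α ≥ 0`, `M ≤ n` and every `Q ∈ 𝒬^α(n)`,
`‖T_n Φ(Q)‖ ≥ μ_M − √M (γh + (1+α) γQ γu γv) / √n`. -/
theorem social_cost_lower_bound
    (γh γu γv γQ : ℝ) (hγh : 0 < γh) (hγu : 0 < γu) (hγv : 0 < γv) (hγQ : 0 < γQ)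
    (H U V : ℕ → ℂ)
    (hH : ∀ i, ‖H i‖ ≤ γh) (hU : ∀ i, ‖U i‖ ≤ γu)
    (hV : ∀ i, ‖V i‖ ≤ γv)
    (γ : ℕ → ℝ) (hγ : ∀ i, 0 < γ i) (hγQ' : ∀ i, γ i ≤ γQ)
    (n : ℕ) (α : ℝ) (hα : 0 ≤ α) (M : ℕ) (hMn : M ≤ n) (Q : Matrix (Fin n) (Fin n) ℂ)
    (hQ : Q ∈ QSet n α γ) :
    muSeq H U V γ M - Real.sqrt M * (γh + (1 + α) * γQ * γu * γv) / Real.sqrt n ≤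
      l2opNorm (Tmat n * PhiMat n H U V Q) := by
  obtain ⟨hdom, hdiag⟩ := hQ
  set C : ℝ := γh + (1 + α) * γQ * γu * γv with hC
  have hC0 : 0 ≤ C := by positivity
  set e : Fin M → Fin n := Fin.castLE hMn with he
  have hinj : Function.Injective e := Fin.castLE_injective hMn
  set P := PhiMat n H U V Q with hP
  -- entries of `Φ(Q)`
  have hPe : ∀ i j, P i j = (if i = j then H i else 0) - U i * Q i j * V j := by
    intro i j
    simp [hP, PhiMat, Matrix.diagonal_apply]
  -- column sums
  have hcol : ∀ j, ‖∑ i, P i j‖ ≤ C := by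
    intro j
    have hs : ∑ i, P i j = H j - ∑ i : Fin n, U i * Q i j * V j := by
      simp [hPe, Finset.sum_sub_distrib]
    have hQs : ∑ i, ‖Q i j‖ ≤ (1 + α) * γQ := by
      rw [← Finset.add_sum_erase _ _ (Finset.mem_univ j)]
      have h1 := hdom j
      have h2 := (hdiag j).trans (hγQ' j)
      nlinarith
    have hb : ‖∑ i : Fin n, U i * Q i j * V j‖ ≤ (∑ i, ‖Q i j‖) * (γu * γv) := by
      rw [Finset.sum_mul]
      refine (norm_sum_le _ _).trans (Finset.sum_le_sum fun i _ => ?_)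
      rw [norm_mul, norm_mul]
      calc ‖U i‖ * ‖Q i j‖ * ‖V j‖ ≤ γu * ‖Q i j‖ * γv := by
            gcongr
            · exact hU i
            · exact hV j
        _ = _ := by ring
    rw [hs]
    calc _ ≤ ‖H j‖ + ‖∑ i : Fin n, U i * Q i j * V j‖ := norm_sub_le _ _
      _ ≤ γh + (1 + α) * γQ * (γu * γv) := by
          gcongr
          · exact hH j
          · exact hb.trans (by gcongr)
      _ = C := by rw [hC]; ring
  let R : Matrix (Fin M) (Fin M) ℂ := Matrix.of fun _ j => (n : ℂ)⁻¹ * ∑ k, P k (e j)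
  have hR : l2opNorm R ≤ M * ((n : ℝ)⁻¹ * C) := by
    refine l2opNorm_le_of_entries R _ (by positivity) fun i j => ?_
    simp only [R, Matrix.of_apply, norm_mul, norm_inv, Complex.norm_natCast]
    gcongr
    exact hcol _
  have hR' : (M : ℝ) * ((n : ℝ)⁻¹ * C) ≤ Real.sqrt M * C / Real.sqrt n := by
    have h1 : Real.sqrt M ≤ Real.sqrt n := Real.sqrt_le_sqrt (by exact_mod_cast hMn)
    rcases Nat.eq_zero_or_pos n with h0 | h0
    · subst h0; simp
    have hn : 0 < Real.sqrt n := Real.sqrt_pos.2 (by exact_mod_cast h0)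
    have hn2 : Real.sqrt n * Real.sqrt n = n := Real.mul_self_sqrt (by positivity)
    have hM2 : Real.sqrt M * Real.sqrt M = M := Real.mul_self_sqrt (by positivity)
    rw [le_div_iff₀ hn]
    calc (M : ℝ) * ((n : ℝ)⁻¹ * C) * Real.sqrt n
        = Real.sqrt M * C * (Real.sqrt M / Real.sqrt n) := by
          field_simp; rw [pow_two, pow_two, hM2, hn2]; ring
      _ ≤ Real.sqrt M * C * 1 := by
          gcongr
          exact (div_le_one hn).2 h1
      _ = _ := mul_one _
  let Z : Matrix (Fin M) (Fin M) ℂ := Q.submatrix e e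
  let S : Matrix (Fin M) (Fin M) ℂ := Matrix.diagonal (fun i : Fin M => H i) -
      Matrix.diagonal (fun i : Fin M => U i) * Z * Matrix.diagonal (fun i : Fin M => V i)
  have hS : S = (Tmat n * P).submatrix e e + R := by
    ext i j
    simp only [S, R, Z, Tmat, Matrix.sub_mul, Matrix.one_mul, Matrix.add_apply,
      Matrix.submatrix_apply, Matrix.sub_apply, Matrix.smul_mul, Matrix.smul_apply,
      Matrix.of_apply, smul_eq_mul, hPe (e i) (e j)]
    simp [Matrix.mul_apply, Matrix.diagonal_apply, hinj.eq_iff, he]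
  have hmu : muSeq H U V γ M ≤ l2opNorm S := by
    refine csInf_le ⟨0, ?_⟩ ⟨Z, fun i => hdiag (e i), rfl⟩
    rintro r ⟨Z', -, rfl⟩
    exact l2opNorm_nonneg _
  have hadd : l2opNorm S ≤ l2opNorm ((Tmat n * P).submatrix e e) + l2opNorm R := by
    rw [hS]
    open scoped Matrix.Norms.L2Operator in
    exact norm_add_le ((Tmat n * P).submatrix e e) R
  have hsub := l2opNorm_submatrix_le (Tmat n * P) e hinj
  linarith
end

section
/- (Theorem 4, matrix formalization.) Fix reals γ_h, γ_u, γ_v, γ_Q > 0, sequences H, U, V : ℕ → ℂ with |H_i| ≤ γ_h, |U_i| ≤ γ_u, |V_i| ≤ γ_v for all i, bounds γ_i ∈ (0, γ_Q], and a function α : ℕ → [0,∞) with α(n)/√n → 0. Define the two-block scaled H₂ costs ψ₂^o(n) := inf_{Q ∈ 𝒬^{α(n)}(n)} (1/√n)‖[T_n Φ(Q); Q]‖_F and μ₂^o(n) := inf_{Q ∈ 𝒬^{α(n)}(n)} (1/√n)‖[Φ(Q); Q]‖_F. Then |ψ₂^o(n) − μ₂^o(n)| ≤ (γ_h + (1+α(n))γ_u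 γ_Q γ_v)/√n for every n, and hence ψ₂^o(n) − μ₂^o(n) → 0 as n → ∞. -/
/-- The Frobenius norm of a complex matrix. -/
noncomputable def frobNorm {m n : Type*} [Fintype m] [Fintype n] (A : Matrix m n ℂ) : ℝ :=
  Real.sqrt (∑ i, ∑ j, ‖A i j‖ ^ 2)

section helpers

attribute [local instance] Matrix.frobeniusNormedAddCommGroup

theorem frobNorm_eq_norm {m n : Type*} [Fintype m] [Fintype n] (A : Matrix m n ℂ) :
    frobNorm A = ‖A‖ := by
  rw [Matrix.frobenius_norm_def, frobNorm, Real.sqrt_eq_rpow]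
  simp only [Real.rpow_two]

theorem frobNorm_abs_sub_le {m n : Type*} [Fintype m] [Fintype n] (A B : Matrix m n ℂ) :
    |frobNorm A - frobNorm B| ≤ frobNorm (A - B) := by
  simp only [frobNorm_eq_norm]
  exact abs_norm_sub_norm_le A B

end helpers

theorem sInf_aux {X : Type*} (S : Set X) (hS : S.Nonempty) (f g : X → ℝ) (c : ℝ)
    (hf : ∀ x, 0 ≤ f x) (hfg : ∀ x ∈ S, f x ≤ g x + c) :
    sInf {r : ℝ | ∃ x ∈ S, r = f x} ≤ sInf {r : ℝ | ∃ x ∈ S, r = g x} + c := by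
  rw [← sub_le_iff_le_add]
  obtain ⟨x0, hx0⟩ := hS
  refine le_csInf (s := {r : ℝ | ∃ x ∈ S, r = g x}) ⟨g x0, x0, hx0, rfl⟩ ?_
  rintro _ ⟨x, hx, rfl⟩
  rw [sub_le_iff_le_add]
  have hbdd : BddBelow {r : ℝ | ∃ x ∈ S, r = f x} := by
    refine ⟨0, ?_⟩
    rintro _ ⟨y, _, rfl⟩
    exact hf y
  exact le_trans (csInf_le hbdd ⟨x, hx, rfl⟩) (hfg x hx)

theorem col_sum_bound (γh γu γv γQ : ℝ) (hγu : 0 < γu) (hγv : 0 < γv)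
    (H U V : ℕ → ℂ)
    (hH : ∀ i, ‖H i‖ ≤ γh) (hU : ∀ i, ‖U i‖ ≤ γu) (hV : ∀ i, ‖V i‖ ≤ γv)
    (γ : ℕ → ℝ) (hγQ' : ∀ i, γ i ≤ γQ)
    (a : ℝ) (ha : 0 ≤ a) (n : ℕ) (Q : Matrix (Fin n) (Fin n) ℂ) (hQ : Q ∈ QSet n a γ)
    (j : Fin n) :
    ‖∑ k, PhiMat n H U V Q k j‖ ≤ γh + (1 + a) * γu * γQ * γv := by
  have h1 : ∑ k, PhiMat n H U V Q k j = H j - ∑ k : Fin n, U k * Q k j * V j := by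
    simp [PhiMat, Matrix.sub_apply, Matrix.diagonal_apply, Matrix.mul_diagonal,
      Matrix.diagonal_mul, Finset.sum_sub_distrib]
  have h2 : ∑ k, ‖Q k j‖ ≤ (1 + a) * γQ := by
    rw [← Finset.add_sum_erase _ _ (Finset.mem_univ j)]
    have := hQ.1 j
    have h3 : ‖Q j j‖ ≤ γQ := (hQ.2 j).trans (hγQ' _)
    nlinarith
  rw [h1]
  have h4 : ‖∑ k : Fin n, U k * Q k j * V j‖ ≤ ∑ k : Fin n, γu * ‖Q k j‖ * γv := by
    refine (norm_sum_le _ _).trans (Finset.sum_le_sum fun k _ => ?_)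
    rw [norm_mul, norm_mul]
    have := hU k
    have := hV j
    gcongr
  have h6 : ∑ k : Fin n, γu * ‖Q k j‖ * γv = γu * (∑ k, ‖Q k j‖) * γv := by
    rw [← Finset.sum_mul, ← Finset.mul_sum]
  rw [h6] at h4
  have h5 : γu * (∑ k, ‖Q k j‖) * γv ≤ γu * ((1 + a) * γQ) * γv := by gcongr
  have := norm_sub_le (H j) (∑ k : Fin n, U k * Q k j * V j)
  have := hH j
  linarith

theorem frob_diff_bound (n : ℕ) (P Q : Matrix (Fin n) (Fin n) ℂ) (C : ℝ) (hC : 0 ≤ C)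
    (hP : ∀ j, ‖∑ k, P k j‖ ≤ C) :
    |frobNorm (Matrix.fromRows (Tmat n * P) Q) - frobNorm (Matrix.fromRows P Q)| ≤ C := by
  refine (frobNorm_abs_sub_le _ _).trans ?_
  rw [frobNorm]
  apply Real.sqrt_le_iff.2 ⟨hC, ?_⟩
  rw [Fintype.sum_sum_type]
  have e1 : ∀ i j : Fin n, (Tmat n * P) i j - P i j = -((n : ℂ)⁻¹ * ∑ k, P k j) := by
    intro i j
    rw [Tmat, Matrix.sub_mul, Matrix.one_mul, Matrix.sub_apply, Matrix.smul_mul,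
      Matrix.smul_apply, Matrix.mul_apply]
    simp
  simp only [Matrix.sub_apply, Matrix.fromRows_apply_inl, Matrix.fromRows_apply_inr, e1,
    sub_self, norm_neg, norm_mul, norm_inv, Complex.norm_natCast]
  have : ∑ _i : Fin n, ∑ j : Fin n, ((n : ℝ)⁻¹ * ‖∑ k, P k j‖) ^ 2 ≤
      ∑ _i : Fin n, ∑ _j : Fin n, ((n : ℝ)⁻¹ * C) ^ 2 := by
    gcongr with i _ j _
    exact hP j
  simp only [Finset.sum_const, Finset.card_univ, Fintype.card_fin, nsmul_eq_mul] at this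
  simp only [norm_zero, ne_eq, OfNat.ofNat_ne_zero, not_false_eq_true, zero_pow,
    Finset.sum_const_zero, add_zero]
  refine (by simpa using this : _ ≤ _).trans ?_
  rcases Nat.eq_zero_or_pos n with h | h
  · subst h
    simp
    positivity
  · apply le_of_eq
    field_simp

/-- Theorem 4: the two-block scaled-`H₂` costs
`ψ₂^o(n) = inf_{Q ∈ 𝒬^{α(n)}(n)} (1/√n) ‖[T_n Φ(Q); Q]‖_F` and
`μ₂^o(n) = inf_{Q ∈ 𝒬^{α(n)}(n)} (1/√n) ‖[Φ(Q); Q]‖_F` satisfy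
`|ψ₂^o(n) − μ₂^o(n)| ≤ (γh + (1+α(n)) γu γQ γv)/√n`, hence `ψ₂^o(n) − μ₂^o(n) → 0`. -/
theorem two_block_H2_theorem
    (γh γu γv γQ : ℝ) (hγh : 0 < γh) (hγu : 0 < γu) (hγv : 0 < γv) (hγQ : 0 < γQ)
    (H U V : ℕ → ℂ)
    (hH : ∀ i, ‖H i‖ ≤ γh) (hU : ∀ i, ‖U i‖ ≤ γu)
    (hV : ∀ i, ‖V i‖ ≤ γv)
    (γ : ℕ → ℝ) (hγ : ∀ i, 0 < γ i) (hγQ' : ∀ i, γ i ≤ γQ)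
    (α : ℕ → ℝ) (hα : ∀ n, 0 ≤ α n)
    (hαn : Filter.Tendsto (fun n => α n / Real.sqrt n) Filter.atTop (nhds 0)) :
    (∀ n : ℕ,
      |sInf {r : ℝ | ∃ Q ∈ QSet n (α n) γ,
          r = (1 / Real.sqrt n) * frobNorm (Matrix.fromRows (Tmat n * PhiMat n H U V Q) Q)} -
        sInf {r : ℝ | ∃ Q ∈ QSet n (α n) γ,
          r = (1 / Real.sqrt n) * frobNorm (Matrix.fromRows (PhiMat n H U V Q) Q)}| ≤
        (γh + (1 + α n) * γu * γQ * γv) / Real.sqrt n) ∧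
    Filter.Tendsto
      (fun n => sInf {r : ℝ | ∃ Q ∈ QSet n (α n) γ,
          r = (1 / Real.sqrt n) * frobNorm (Matrix.fromRows (Tmat n * PhiMat n H U V Q) Q)} -
        sInf {r : ℝ | ∃ Q ∈ QSet n (α n) γ,
          r = (1 / Real.sqrt n) * frobNorm (Matrix.fromRows (PhiMat n H U V Q) Q)})
      Filter.atTop (nhds 0) := by
  have key : ∀ n : ℕ,
      |sInf {r : ℝ | ∃ Q ∈ QSet n (α n) γ,
          r = (1 / Real.sqrt n) * frobNorm (Matrix.fromRows (Tmat n * PhiMat n H U V Q) Q)} -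
        sInf {r : ℝ | ∃ Q ∈ QSet n (α n) γ,
          r = (1 / Real.sqrt n) * frobNorm (Matrix.fromRows (PhiMat n H U V Q) Q)}| ≤
        (γh + (1 + α n) * γu * γQ * γv) / Real.sqrt n := by
    intro n
    have hne : (QSet n (α n) γ).Nonempty := ⟨0, by simp, fun i => by simpa using (hγ i).le⟩
    have ha := hα n
    have hC : 0 ≤ γh + (1 + α n) * γu * γQ * γv := by positivity
    have hb : ∀ Q ∈ QSet n (α n) γ, _ := fun Q hQ =>
      abs_le.1 (frob_diff_bound n (PhiMat n H U V Q) Q _ hC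
        (col_sum_bound γh γu γv γQ hγu hγv H U V hH hU hV γ hγQ' (α n) ha n Q hQ))
    have hs : 0 ≤ 1 / Real.sqrt n := by positivity
    have hn : ∀ (M : Matrix (Fin n ⊕ Fin n) (Fin n) ℂ), 0 ≤ 1 / Real.sqrt n * frobNorm M :=
      fun M => mul_nonneg hs (Real.sqrt_nonneg _)
    rw [abs_sub_le_iff, sub_le_iff_le_add', sub_le_iff_le_add']
    constructor
    · refine sInf_aux _ hne _ _ _ (fun Q => hn _) fun Q hQ => ?_
      rw [div_eq_mul_one_div (γh + (1 + α n) * γu * γQ * γv) (Real.sqrt n),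
        mul_comm (γh + (1 + α n) * γu * γQ * γv) (1 / Real.sqrt n), ← mul_add]
      exact mul_le_mul_of_nonneg_left (by linarith [(hb Q hQ).2]) hs
    · refine sInf_aux _ hne _ _ _ (fun Q => hn _) fun Q hQ => ?_
      rw [div_eq_mul_one_div (γh + (1 + α n) * γu * γQ * γv) (Real.sqrt n),
        mul_comm (γh + (1 + α n) * γu * γQ * γv) (1 / Real.sqrt n), ← mul_add]
      exact mul_le_mul_of_nonneg_left (by linarith [(hb Q hQ).1]) hs
  refine ⟨key, squeeze_zero_norm key ?_⟩
  have h1 : Filter.Tendsto (fun n : ℕ => (γh + γu * γQ * γv) / Real.sqrt n)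
      Filter.atTop (nhds 0) :=
    Filter.Tendsto.const_div_atTop
      (Real.tendsto_sqrt_atTop.comp tendsto_natCast_atTop_atTop) _
  have h2 := h1.add (hαn.mul_const (γu * γQ * γv))
  rw [zero_mul, add_zero] at h2
  refine h2.congr fun n => ?_
  ring
end
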